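/- Let n ≥ 1 and let E ⊆ ℝ^n. Then E has Lebesgue (outer) measure 0 if and only if there exists a martingale d on [0,1)^n that succeeds at every point x ∈ E^#, where E^# = [0,1)^n ∩ ⋃_{t∈ℤ^n}(E+t). -/

import Mathlib

open MeasureTheory Filter

/-- The dyadic cube `Q_r(u)` in `ℝ^n`. -/
def dyadicCube (n r : ℕ) (u : Fin n → ℤ) : Set (Fin n → ℝ) :=
  {x | ∀ i, (u i : ℝ) * 2 ^ (-(r : ℤ)) ≤ x i ∧ x i < ((u i : ℝ) + 1) * 2 ^ (-(r : ℤ))}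

/-- `u` indexes an `r`-dyadic cube inside `[0,1)^n`. -/
def validIndex (r : ℕ) {n : ℕ} (u : Fin n → ℤ) : Prop := ∀ i, 0 ≤ u i ∧ u i < 2 ^ r

/-- A martingale on `[0,1)^n`, presented as a nonnegative function on dyadic-cube
indices satisfying the fairness (averaging) condition on cubes inside `[0,1)^n`. -/
structure DyadicMartingale (n : ℕ) where
  toFun : ℕ → (Fin n → ℤ) → ℝ
  nonneg : ∀ r u, 0 ≤ toFun r u
  fair : ∀ r u, validIndex r u →
    toFun r u = (2 : ℝ) ^ (-(n : ℤ)) *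
      ∑ a : Fin n → Bool, toFun (r + 1) (fun i => 2 * u i + if a i then 1 else 0)

/-- The index of the unique `r`-dyadic cube containing `x ∈ [0,1)^n`. -/
noncomputable def dyadicIndex (n r : ℕ) (x : Fin n → ℝ) : Fin n → ℤ := fun i => ⌊x i * 2 ^ r⌋

/-- `d` succeeds at `x`: `limsup_r d^{(r)}(x) = ∞`. -/
def succeedsAt {n : ℕ} (d : DyadicMartingale n) (x : Fin n → ℝ) : Prop :=
  Filter.atTop.limsup (fun r => ((d.toFun r (dyadicIndex n r x) : ℝ) : EReal)) = ⊤

/-- The unit cube `[0,1)^n`. -/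
def unitCube (n : ℕ) : Set (Fin n → ℝ) := {x | ∀ i, 0 ≤ x i ∧ x i < 1}

/-- `E^# = [0,1)^n ∩ ⋃_{t ∈ ℤ^n} (E + t)`. -/
def sharp {n : ℕ} (E : Set (Fin n → ℝ)) : Set (Fin n → ℝ) :=
  unitCube n ∩ ⋃ t : Fin n → ℤ, (fun x => x + fun i => (t i : ℝ)) '' E

/-- A martingale is computable if its values can be uniformly computably
approximated to within `2^{-s}` by rationals. -/
def DyadicMartingale.IsComputable {n : ℕ} (d : DyadicMartingale n) : Prop :=
  ∃ dh : ℕ × ℕ × (Fin n → ℤ) → ℚ,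
    Computable dh ∧ (∀ p, 0 ≤ dh p) ∧
    ∀ s r u, validIndex r u →
      |(dh (s, r, u) : ℝ) - d.toFun r u| ≤ 2 ^ (-(s : ℤ))

/-- `E ⊆ ℝ^n` has computable measure 0. -/
def HasComputableMeasureZero {n : ℕ} (E : Set (Fin n → ℝ)) : Prop :=
  ∃ d : DyadicMartingale n, d.IsComputable ∧ ∀ x ∈ sharp E, succeedsAt d x

/-- `x ∈ ℝ^n` is computably random: no computable martingale succeeds at the
unique translate `x + t ∈ [0,1)^n` with `t ∈ ℤ^n`. -/
def ComputablyRandom {n : ℕ} (x : Fin n → ℝ) : Prop :=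
  ∀ d : DyadicMartingale n, d.IsComputable → ¬ succeedsAt d (fun i => Int.fract (x i))

lemma mem_dyadicCube_iff {n r : ℕ} {u : Fin n → ℤ} {x : Fin n → ℝ} :
    x ∈ dyadicCube n r u ↔ dyadicIndex n r x = u := by
  have h2 : (0 : ℝ) < 2 ^ r := by positivity
  simp only [dyadicCube, dyadicIndex, Set.mem_ofPred_eq, funext_iff, Int.floor_eq_iff, zpow_neg,
    zpow_natCast, ← div_eq_mul_inv, div_le_iff₀ h2, lt_div_iff₀ h2]

lemma dyadicIndex_eq_succ_ediv_two (n r : ℕ) (x : Fin n → ℝ) (i : Fin n) :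
    dyadicIndex n r x i = dyadicIndex n (r + 1) x i / 2 := by
  have h : x i * 2 ^ r = x i * 2 ^ (r + 1) / ((2 : ℕ) : ℝ) := by
    push_cast
    ring
  rw [dyadicIndex, dyadicIndex, h, Int.floor_div_natCast]
  rfl

lemma dyadicCube_eq_iUnion_children (n r : ℕ) (u : Fin n → ℤ) :
    dyadicCube n r u =
      ⋃ a : Fin n → Bool, dyadicCube n (r + 1) (fun i => 2 * u i + if a i then 1 else 0) := by
  ext x
  simp only [Set.mem_iUnion, mem_dyadicCube_iff, funext_iff, dyadicIndex_eq_succ_ediv_two n r]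
  constructor
  · intro h
    refine ⟨fun i => decide (dyadicIndex n (r + 1) x i % 2 = 1), fun i => ?_⟩
    have := h i
    simp only [decide_eq_true_eq]
    split_ifs <;> omega
  · rintro ⟨a, ha⟩ i
    rw [ha i]
    split_ifs <;> omega

lemma pairwise_disjoint_children (n r : ℕ) (u : Fin n → ℤ) :
    Pairwise (Function.onFun Disjoint fun a : Fin n → Bool =>
      dyadicCube n (r + 1) (fun i => 2 * u i + if a i then 1 else 0)) := by
  intro a b hab
  refine Set.disjoint_left.2 fun x hx hy => hab ?_
  rw [mem_dyadicCube_iff] at hx hy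
  ext i
  have := congrFun (hx.symm.trans hy) i
  cases ha : a i <;> cases hb : b i <;> simp_all

lemma dyadicCube_eq_pi (n r : ℕ) (u : Fin n → ℤ) :
    dyadicCube n r u = Set.univ.pi fun i =>
      Set.Ico ((u i : ℝ) * 2 ^ (-(r : ℤ))) (((u i : ℝ) + 1) * 2 ^ (-(r : ℤ))) := by
  ext x
  simp [dyadicCube]

lemma measurableSet_dyadicCube (n r : ℕ) (u : Fin n → ℤ) : MeasurableSet (dyadicCube n r u) := by
  rw [dyadicCube_eq_pi]
  exact MeasurableSet.univ_pi fun _ => measurableSet_Ico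

lemma volume_dyadicCube (n r : ℕ) (u : Fin n → ℤ) :
    volume (dyadicCube n r u) = ENNReal.ofReal (((2 : ℝ) ^ (r * n))⁻¹) := by
  rw [dyadicCube_eq_pi, Real.volume_pi_Ico]
  simp only [add_mul, one_mul, add_sub_cancel_left, Finset.prod_const, Finset.card_univ,
    Fintype.card_fin, zpow_neg, zpow_natCast]
  rw [← ENNReal.ofReal_pow (by positivity), inv_pow, pow_mul]

lemma validIndex_child {n r : ℕ} {u : Fin n → ℤ} (hu : validIndex r u) (a : Fin n → Bool) :
    validIndex (r + 1) (fun i => 2 * u i + if a i then 1 else 0) := by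
  intro i
  have := hu i
  rw [pow_succ]
  constructor <;> dsimp only <;> split_ifs <;> omega

/-- The dyadic densities of a finite measure form a martingale. -/
noncomputable def DyadicMartingale.ofMeasure {n : ℕ} (μ : Measure (Fin n → ℝ))
    [IsFiniteMeasure μ] : DyadicMartingale n where
  toFun r u := 2 ^ (r * n) * μ.real (dyadicCube n r u)
  nonneg r u := by positivity
  fair r u _ := by
    rw [dyadicCube_eq_iUnion_children, measureReal_iUnion_fintype
      (pairwise_disjoint_children n r u) (fun _ => measurableSet_dyadicCube _ _ _),
      ← Finset.mul_sum, ← mul_assoc, add_one_mul, pow_add]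
    congr 1
    rw [zpow_neg, zpow_natCast]
    field_simp

/-- Kolmogorov–Doob maximal inequality on a dyadic cube, up to a finite depth. -/
lemma DyadicMartingale.volume_exists_le_le {n : ℕ} (d : DyadicMartingale n) {c : ℝ} (hc : 0 < c)
    (N : ℕ) : ∀ (r : ℕ) (u : Fin n → ℤ), validIndex r u →
      volume {x | x ∈ dyadicCube n r u ∧
        ∃ k ≤ N, c ≤ d.toFun (r + k) (dyadicIndex n (r + k) x)} ≤
      ENNReal.ofReal (d.toFun r u / c * ((2 : ℝ) ^ (r * n))⁻¹) := by
  have large : ∀ (N r : ℕ) (u : Fin n → ℤ), c ≤ d.toFun r u →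
      volume {x | x ∈ dyadicCube n r u ∧
        ∃ k ≤ N, c ≤ d.toFun (r + k) (dyadicIndex n (r + k) x)} ≤
      ENNReal.ofReal (d.toFun r u / c * ((2 : ℝ) ^ (r * n))⁻¹) := by
    intro N r u h
    refine (measure_mono fun x hx => hx.1).trans ?_
    rw [volume_dyadicCube]
    refine ENNReal.ofReal_le_ofReal (le_mul_of_one_le_left (by positivity) ?_)
    rwa [one_le_div hc]
  induction N with
  | zero =>
    intro r u _
    by_cases h : c ≤ d.toFun r u
    · exact large 0 r u h
    · refine (measure_mono (t := ∅) ?_).trans (by simp)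
      rintro x ⟨hx, k, hk, hd⟩
      obtain rfl : k = 0 := by omega
      rw [mem_dyadicCube_iff] at hx
      rw [add_zero, hx] at hd
      exact h hd
  | succ N ih =>
    intro r u hu
    by_cases h : c ≤ d.toFun r u
    · exact large _ r u h
    · have hsub : {x | x ∈ dyadicCube n r u ∧
          ∃ k ≤ N + 1, c ≤ d.toFun (r + k) (dyadicIndex n (r + k) x)} ⊆
          ⋃ a : Fin n → Bool,
            {x | x ∈ dyadicCube n (r + 1) (fun i => 2 * u i + if a i then 1 else 0) ∧
              ∃ k ≤ N, c ≤ d.toFun (r + 1 + k) (dyadicIndex n (r + 1 + k) x)} := by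
        rintro x ⟨hx, k, hk, hd⟩
        have hk0 : k ≠ 0 := by
          rintro rfl
          rw [mem_dyadicCube_iff] at hx
          rw [add_zero, hx] at hd
          exact h hd
        obtain ⟨k, rfl⟩ := Nat.exists_eq_succ_of_ne_zero hk0
        rw [dyadicCube_eq_iUnion_children, Set.mem_iUnion] at hx
        obtain ⟨a, ha⟩ := hx
        refine Set.mem_iUnion.2 ⟨a, ha, k, by omega, ?_⟩
        rwa [add_assoc, add_comm 1 k]
      refine (measure_mono hsub).trans ((measure_iUnion_fintype_le _ _).trans ?_)
      refine (Finset.sum_le_sum fun a _ => ih _ _ (validIndex_child hu a)).trans ?_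
      rw [← ENNReal.ofReal_sum_of_nonneg fun a _ => mul_nonneg
        (div_nonneg (d.nonneg _ _) hc.le) (by positivity)]
      refine ENNReal.ofReal_le_ofReal (le_of_eq ?_)
      rw [d.fair r u hu, ← Finset.sum_mul, ← Finset.sum_div, add_one_mul, pow_add, zpow_neg,
        zpow_natCast]
      field_simp

lemma unitCube_eq_dyadicCube (n : ℕ) : unitCube n = dyadicCube n 0 0 := by
  ext x
  simp [unitCube, dyadicCube]

lemma DyadicMartingale.volume_unitCube_exists_le_le {n : ℕ} (d : DyadicMartingale n) {c : ℝ}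
    (hc : 0 < c) :
    volume {x | x ∈ unitCube n ∧ ∃ r, c ≤ d.toFun r (dyadicIndex n r x)} ≤
      ENNReal.ofReal (d.toFun 0 0 / c) := by
  have hU : {x | x ∈ unitCube n ∧ ∃ r, c ≤ d.toFun r (dyadicIndex n r x)} =
      ⋃ N : ℕ, {x | x ∈ dyadicCube n 0 0 ∧
        ∃ k ≤ N, c ≤ d.toFun (0 + k) (dyadicIndex n (0 + k) x)} := by
    ext x
    simp only [unitCube_eq_dyadicCube, zero_add, Set.mem_ofPred_eq, Set.mem_iUnion]
    constructor
    · rintro ⟨hx, r, hr⟩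
      exact ⟨r, hx, r, le_rfl, hr⟩
    · rintro ⟨N, hx, r, -, hr⟩
      exact ⟨hx, r, hr⟩
  have hmono : Monotone fun N : ℕ => {x | x ∈ dyadicCube n 0 0 ∧
        ∃ k ≤ N, c ≤ d.toFun (0 + k) (dyadicIndex n (0 + k) x)} := by
    rintro M N hMN x ⟨hx, k, hk, hd⟩
    exact ⟨hx, k, hk.trans hMN, hd⟩
  rw [hU, hmono.measure_iUnion]
  refine iSup_le fun N => ?_
  simpa using d.volume_exists_le_le hc N 0 0 (fun i => by simp)

lemma succeedsAt.exists_le {n : ℕ} {d : DyadicMartingale n} {x : Fin n → ℝ}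
    (h : succeedsAt d x) (c : ℝ) : ∃ r, c ≤ d.toFun r (dyadicIndex n r x) := by
  have hlt : (c : EReal) <
      atTop.limsup (fun r => ((d.toFun r (dyadicIndex n r x) : ℝ) : EReal)) := by
    rw [show _ = (⊤ : EReal) from h]
    exact EReal.coe_lt_top c
  obtain ⟨r, hr⟩ := (frequently_lt_of_lt_limsup (by isBoundedDefault) hlt).exists
  exact ⟨r, (EReal.coe_lt_coe_iff.1 hr).le⟩

lemma DyadicMartingale.volume_eq_zero_of_succeedsAt {n : ℕ} (d : DyadicMartingale n)
    {S : Set (Fin n → ℝ)} (hS : S ⊆ unitCube n) (h : ∀ x ∈ S, succeedsAt d x) :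
    volume S = 0 := by
  have hle : ∀ k : ℕ, volume S ≤ ENNReal.ofReal (d.toFun 0 0 / ((k : ℝ) + 1)) := fun k =>
    (measure_mono fun x hx => And.intro (hS hx) ((h x hx).exists_le _)).trans
      (d.volume_unitCube_exists_le_le (by positivity))
  have hlim : Tendsto (fun k : ℕ => ENNReal.ofReal (d.toFun 0 0 / ((k : ℝ) + 1))) atTop
      (nhds 0) := by
    rw [← ENNReal.ofReal_zero]
    refine ENNReal.tendsto_ofReal (Tendsto.div_atTop tendsto_const_nhds ?_)
    exact tendsto_atTop_add_const_right _ _ tendsto_natCast_atTop_atTop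
  exact nonpos_iff_eq_zero.1 (ge_of_tendsto' hlim hle)

lemma eventually_dyadicCube_subset {n : ℕ} {U : Set (Fin n → ℝ)} (hU : IsOpen U)
    {x : Fin n → ℝ} (hx : x ∈ U) :
    ∀ᶠ r in atTop, dyadicCube n r (dyadicIndex n r x) ⊆ U := by
  obtain ⟨ε, hε, hball⟩ := Metric.isOpen_iff.1 hU x hx
  have hlim : Tendsto (fun r : ℕ => (2⁻¹ : ℝ) ^ r) atTop (nhds 0) :=
    tendsto_pow_atTop_nhds_zero_of_lt_one (by norm_num) (by norm_num)
  filter_upwards [hlim.eventually_lt_const hε] with r hr y hy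
  refine hball ((dist_pi_lt_iff hε).2 fun i => lt_of_le_of_lt ?_ hr)
  have h1 := hy i
  have h2 := (mem_dyadicCube_iff.2 rfl : x ∈ dyadicCube n r (dyadicIndex n r x)) i
  rw [zpow_neg, zpow_natCast, ← inv_pow, add_one_mul] at h1 h2
  rw [Real.dist_eq, abs_le]
  constructor <;> linarith [h1.1, h1.2, h2.1, h2.2]

lemma exists_martingale_succeedsAt_of_volume_eq_zero {n : ℕ} {S : Set (Fin n → ℝ)}
    (hS : volume S = 0) : ∃ d : DyadicMartingale n, ∀ x ∈ S, succeedsAt d x := by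
  have hex : ∀ k : ℕ, ∃ U, U ⊇ S ∧ IsOpen U ∧ volume U ≤ (2⁻¹ : ENNReal) ^ k := by
    intro k
    obtain ⟨U, hSU, hU, hlt⟩ := S.exists_isOpen_lt_of_lt (μ := volume) ((2⁻¹ : ENNReal) ^ k)
      (by rw [hS]; exact ENNReal.pow_pos (by simp) k)
    exact ⟨U, hSU, hU, hlt.le⟩
  choose U hSU hU hvol using hex
  let μ : Measure (Fin n → ℝ) := Measure.sum fun k => volume.restrict (U k)
  have hfin : IsFiniteMeasure μ := by
    refine ⟨?_⟩
    rw [Measure.sum_apply _ MeasurableSet.univ]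
    simp only [Measure.restrict_apply_univ]
    refine (ENNReal.tsum_le_tsum hvol).trans_lt ?_
    rw [ENNReal.tsum_geometric]
    simp
  refine ⟨DyadicMartingale.ofMeasure μ, fun x hx => ?_⟩
  refine Tendsto.limsup_eq (EReal.tendsto_coe_nhds_top_iff.2 (tendsto_atTop.2 fun b => ?_))
  obtain ⟨K, hK⟩ := exists_nat_ge b
  have hev : ∀ᶠ r in atTop, ∀ k ∈ Finset.range K, dyadicCube n r (dyadicIndex n r x) ⊆ U k :=
    (Finset.eventually_all _).2 fun k _ => eventually_dyadicCube_subset (hU k) (hSU k hx)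
  filter_upwards [hev] with r hr
  set Q := dyadicCube n r (dyadicIndex n r x) with hQ
  have hμ : ENNReal.ofReal (K * ((2 : ℝ) ^ (r * n))⁻¹) ≤ μ Q := by
    rw [Measure.sum_apply _ (measurableSet_dyadicCube _ _ _)]
    refine le_trans ?_ (ENNReal.sum_le_tsum (Finset.range K))
    rw [Finset.sum_congr rfl fun k hk => show volume.restrict (U k) Q =
      ENNReal.ofReal (((2 : ℝ) ^ (r * n))⁻¹) by
        rw [Measure.restrict_apply (measurableSet_dyadicCube _ _ _),
          Set.inter_eq_left.2 (hr k hk), hQ, volume_dyadicCube]]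
    rw [Finset.sum_const, Finset.card_range, nsmul_eq_mul, ENNReal.ofReal_mul (by positivity),
      ENNReal.ofReal_natCast]
  have hreal := (ENNReal.ofReal_le_iff_le_toReal (measure_ne_top μ Q)).1 hμ
  rw [← div_eq_mul_inv, div_le_iff₀' (by positivity)] at hreal
  exact hK.trans hreal

lemma volume_iUnion_int_translates_eq_zero {n : ℕ} {S : Set (Fin n → ℝ)} (hS : volume S = 0) :
    volume (⋃ t : Fin n → ℤ, (fun x => x + fun i => (t i : ℝ)) '' S) = 0 := by
  refine measure_iUnion_null fun t => ?_
  rw [Set.image_add_right, measure_preimage_add_right, hS]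

lemma volume_sharp_eq_zero_iff {n : ℕ} {E : Set (Fin n → ℝ)} :
    volume (sharp E) = 0 ↔ volume E = 0 := by
  refine ⟨fun h => measure_mono_null (fun x hx => ?_) (volume_iUnion_int_translates_eq_zero h),
    fun h => measure_mono_null Set.inter_subset_right (volume_iUnion_int_translates_eq_zero h)⟩
  refine Set.mem_iUnion.2 ⟨fun i => ⌊x i⌋, fun i => Int.fract (x i), ⟨?_, ?_⟩, ?_⟩
  · exact fun i => ⟨Int.fract_nonneg _, Int.fract_lt_one _⟩
  · refine Set.mem_iUnion.2 ⟨fun i => -⌊x i⌋, x, hx, ?_⟩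
    ext i
    simp [Int.fract, sub_eq_add_neg]
  · ext i
    simp

/-- For `n ≥ 1` and `E ⊆ ℝ^n`: `E` has Lebesgue (outer) measure 0 iff
some martingale on `[0,1)^n` succeeds at every point of `E^#`. -/
theorem measure_zero_iff_exists_martingale_succeeds_sharp
    (n : ℕ) (hn : 1 ≤ n) (E : Set (Fin n → ℝ)) :
    volume E = 0 ↔ ∃ d : DyadicMartingale n, ∀ x ∈ sharp E, succeedsAt d x := by
  rw [← volume_sharp_eq_zero_iff]
  exact ⟨exists_martingale_succeedsAt_of_volume_eq_zero,
    fun ⟨d, hd⟩ => d.volume_eq_zero_of_succeedsAt Set.inter_subset_left hd⟩
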